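/- Let $\Omega \subsetneq \mathbb{R}^n$ be a nonempty open set, $0 < s < 1$, $p > 1$ with $sp > n$. Then there is a constant $C > 0$ such that for all $u \in C^\infty_c(\Omega)$, $\int_{\Omega}\frac{|u(x)|^p}{\delta(x)^{sp}}\,dx \le C\int_{\Omega}\int_{\Omega}\frac{|u(x)-u(y)|^p}{|x-y|^{n+sp}}\,dx\,dy$, where $\delta(x) = \mathrm{dist}(x, \Omega^c)$. -/

import Mathlib

open MeasureTheory Metric Set

lemma hardy_pow (p a b : ℝ) (hp : 1 < p) : |a| ^ p ≤ 2 ^ p * (|a - b| ^ p + |b| ^ p) := by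
  have h0 : |a| ≤ 2 * max |a - b| |b| := by
    have h1 : |a| ≤ |a - b| + |b| := by simpa using abs_add_le (a - b) b
    have := le_max_left |a - b| |b|
    have := le_max_right |a - b| |b|
    linarith
  have hp0 : 0 ≤ p := by linarith
  calc |a| ^ p ≤ (2 * max |a - b| |b|) ^ p := Real.rpow_le_rpow (abs_nonneg _) h0 hp0
    _ = 2 ^ p * (max |a - b| |b|) ^ p := Real.mul_rpow (by norm_num) (le_max_of_le_left (abs_nonneg _))
    _ ≤ _ := by
      gcongr
      rcases max_cases |a - b| |b| with h | h <;> rw [h.1]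
      · have : 0 ≤ |b| ^ p := by positivity
        linarith
      · have : 0 ≤ |a - b| ^ p := by positivity
        linarith

lemma hardy_lambda (p N t : ℝ) (hN : 0 ≤ N) (hp : 1 < p) (ht : N < t) :
    ∃ l : ℝ, 0 < l ∧ l < 1 ∧ 2 ^ p * (2 / l) ^ N * (2 / l) ^ N * (2 * l) ^ (N + t) ≤ 1 / 2 := by
  have hk : 0 < t - N := by linarith
  refine ⟨(2 ^ (-(p + 3 * N + t + 1))) ^ (1 / (t - N)), by positivity, ?_, ?_⟩
  · apply Real.rpow_lt_one (by positivity) _ (by positivity)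
    apply Real.rpow_lt_one_of_one_lt_of_neg (by norm_num) (by linarith)
  · set l : ℝ := (2 ^ (-(p + 3 * N + t + 1))) ^ (1 / (t - N)) with hl
    have l0 : 0 < l := by positivity
    have e : l ^ (t - N) = 2 ^ (-(p + 3 * N + t + 1)) := by
      rw [hl, ← Real.rpow_mul (by positivity), one_div, inv_mul_cancel₀ hk.ne', Real.rpow_one]
    have : 2 ^ p * (2 / l) ^ N * (2 / l) ^ N * (2 * l) ^ (N + t)
        = (2 ^ p * 2 ^ N * 2 ^ N * 2 ^ (N + t)) * l ^ (t - N) := by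
      rw [Real.div_rpow (by norm_num) l0.le, Real.mul_rpow (by norm_num) l0.le,
        Real.rpow_sub l0, Real.rpow_add l0]
      have : l ^ N ≠ 0 := by positivity
      field_simp
    rw [this, e, ← Real.rpow_add (by norm_num), ← Real.rpow_add (by norm_num),
      ← Real.rpow_add (by norm_num), ← Real.rpow_add (by norm_num)]
    ring_nf
    rw [Real.rpow_neg_one]; norm_num

/-- the region used for averaging -/
def hardyA {E : Type*} [PseudoMetricSpace E] (l : ℝ) (δ : E → ℝ) (x y : E) : Prop :=
  l * δ x / 2 ≤ δ y ∧ δ y ≤ 2 * l * δ x ∧ dist x y ≤ δ x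

lemma hardy_ball {E : Type*} [NormedAddCommGroup E] [NormedSpace ℝ E] [ProperSpace E]
    {Ω : Set E} (hΩ : IsOpen Ω) (hne : (Ωᶜ).Nonempty) {l : ℝ} (l0 : 0 < l) (l1 : l < 1)
    (x : E) (hd : 0 < infDist x Ωᶜ) :
    ∃ c : E, ball c (l * infDist x Ωᶜ / 2) ⊆ {y | hardyA l (fun z => infDist z Ωᶜ) x y} := by
  obtain ⟨z, hz, hxz⟩ := hΩ.isClosed_compl.exists_infDist_eq_dist hne x
  set d := infDist x Ωᶜ
  refine ⟨z + l • (x - z), fun y hy => ?_⟩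
  have hxz' : ‖x - z‖ = d := by rw [hxz, dist_eq_norm]
  have h1 : dist (z + l • (x - z)) z = l * d := by
    rw [dist_eq_norm, add_sub_cancel_left, norm_smul, hxz', Real.norm_of_nonneg l0.le]
  have h2 : dist x (z + l • (x - z)) = (1 - l) * d := by
    rw [dist_eq_norm, show x - (z + l • (x - z)) = (1 - l) • (x - z) by module, norm_smul, hxz',
      Real.norm_of_nonneg (by linarith)]
  have h3 : dist y (z + l • (x - z)) < l * d / 2 := hy
  have h4 : infDist y Ωᶜ ≤ dist y z := infDist_le_dist_of_mem hz
  have h5 : d ≤ infDist y Ωᶜ + dist x y := infDist_le_infDist_add_dist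
  have h6 := dist_triangle y (z + l • (x - z)) z
  have h7 := dist_triangle x (z + l • (x - z)) y
  rw [dist_comm (z + l • (x - z)) y] at h7
  have := mul_pos l0 hd
  refine ⟨?_, ?_, ?_⟩
  · change l * d / 2 ≤ infDist y Ωᶜ
    nlinarith
  · change infDist y Ωᶜ ≤ 2 * l * d
    nlinarith
  · change dist x y ≤ d
    nlinarith

lemma hardy_real {p q a b d e r l : ℝ} (hp : 1 < p) (hq : 0 < q) (l0 : 0 < l) (hd : 0 < d)
    (he : 0 < e) (hr : 0 ≤ r) (hab : r = 0 → a = b) (h1 : e ≤ 2 * l * d) (h2 : r ≤ d) :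
    |a| ^ p / d ^ q ≤ 2 ^ p * (|a - b| ^ p / r ^ q) + 2 ^ p * ((2 * l) ^ q * (|b| ^ p / e ^ q)) := by
  have A : |a - b| ^ p / d ^ q ≤ |a - b| ^ p / r ^ q := by
    rcases hr.eq_or_lt with h | h
    · rw [hab h.symm]; simp [Real.zero_rpow (by linarith : p ≠ 0)]
    · gcongr
  have B : |b| ^ p / d ^ q ≤ (2 * l) ^ q * (|b| ^ p / e ^ q) := by
    have : e ^ q ≤ (2 * l) ^ q * d ^ q := by
      rw [← Real.mul_rpow (by positivity) hd.le]; gcongr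
    rw [div_le_iff₀ (by positivity), mul_comm ((2 * l) ^ q), mul_assoc, div_mul_eq_mul_div,
      le_div_iff₀ (by positivity)]
    gcongr
  calc |a| ^ p / d ^ q ≤ (2 ^ p * (|a - b| ^ p + |b| ^ p)) / d ^ q := by
        gcongr; exact hardy_pow p a b hp
    _ = 2 ^ p * (|a - b| ^ p / d ^ q) + 2 ^ p * (|b| ^ p / d ^ q) := by ring
    _ ≤ _ := by gcongr

lemma hardy_main (n : ℕ) (t p : ℝ) (hp : 1 < p) (hsp : (n : ℝ) < t)
    (Ω : Set (EuclideanSpace ℝ (Fin n))) (hΩ : IsOpen Ω) (hne : (Ωᶜ).Nonempty) :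
    ∃ C : ℝ, 0 < C ∧
      ∀ u : EuclideanSpace ℝ (Fin n) → ℝ, Continuous u →
        (∫⁻ x in Ω, ENNReal.ofReal (|u x| ^ p / infDist x Ωᶜ ^ t)) ≠ ⊤ →
        (∫⁻ x in Ω, ENNReal.ofReal (|u x| ^ p / infDist x Ωᶜ ^ t))
          ≤ ENNReal.ofReal C * ∫⁻ x in Ω, ∫⁻ y in Ω,
            ENNReal.ofReal (|u x - u y| ^ p / dist x y ^ ((n : ℝ) + t)) := by
  have hN : (0:ℝ) ≤ n := Nat.cast_nonneg n
  have hq : 0 < (n:ℝ) + t := by linarith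
  obtain ⟨l, l0, l1, hl⟩ := hardy_lambda p n t hN hp hsp
  set w : ℝ := (volume (ball (0 : EuclideanSpace ℝ (Fin n)) 1)).toReal with hw
  have hwe : volume (ball (0 : EuclideanSpace ℝ (Fin n)) 1) = ENNReal.ofReal w :=
    (ENNReal.ofReal_toReal measure_ball_lt_top.ne).symm
  have w0 : 0 < w := ENNReal.toReal_pos (measure_ball_pos _ _ one_pos).ne' measure_ball_lt_top.ne
  have hpos : ∀ x ∈ Ω, 0 < infDist x Ωᶜ := fun x hx =>
    (hΩ.isClosed_compl.notMem_iff_infDist_pos hne).1 (by simpa using hx)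
  have hpos' : ∀ x, 0 < infDist x Ωᶜ → x ∈ Ω := fun x hx => by
    simpa using (hΩ.isClosed_compl.notMem_iff_infDist_pos hne).2 hx
  set δ : EuclideanSpace ℝ (Fin n) → ℝ := fun x => infDist x Ωᶜ with hδ
  have δc : Continuous δ := continuous_infDist_pt _
  change ∀ x ∈ Ω, 0 < δ x at hpos
  change ∀ x, 0 < δ x → x ∈ Ω at hpos'
  set q : ℝ := (n:ℝ) + t with hqd
  set K : ℝ := (2 / l) ^ (n:ℝ) / w with hK
  have K0 : 0 < K := by positivity
  refine ⟨2 * (K * 2 ^ p), by positivity, fun u hu hfin => ?_⟩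
  change (∫⁻ x in Ω, ENNReal.ofReal (|u x| ^ p / δ x ^ t)) ≠ ⊤ at hfin
  change (∫⁻ x in Ω, ENNReal.ofReal (|u x| ^ p / δ x ^ t)) ≤ _
  set L := ∫⁻ x in Ω, ENNReal.ofReal (|u x| ^ p / δ x ^ t) with hL
  have um : Measurable u := hu.measurable
  have δm : Measurable δ := δc.measurable
  set S : Set (EuclideanSpace ℝ (Fin n) × EuclideanSpace ℝ (Fin n)) :=
    {z | hardyA l δ z.1 z.2} with hS
  have Sm : MeasurableSet S := by
    apply IsClosed.measurableSet
    have e : S = {z | l * δ z.1 / 2 ≤ δ z.2} ∩ ({z | δ z.2 ≤ 2 * l * δ z.1} ∩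
        {z | dist z.1 z.2 ≤ δ z.1}) := rfl
    rw [e]
    refine (isClosed_le (by fun_prop) (by fun_prop)).inter ((isClosed_le (by fun_prop)
      (by fun_prop)).inter (isClosed_le (by fun_prop) (by fun_prop)))
  let B : EuclideanSpace ℝ (Fin n) → ENNReal := fun y =>
    ENNReal.ofReal (K * (2 ^ p * ((2 * l) ^ q * (|u y| ^ p / δ y ^ q))))
  have Bm : Measurable B := by
    apply ENNReal.measurable_ofReal.comp; fun_prop
  let G : EuclideanSpace ℝ (Fin n) → EuclideanSpace ℝ (Fin n) → ENNReal := fun x y =>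
    S.indicator (fun z => B z.2) (x, y)
  have Gm : Measurable (Function.uncurry G) := (Bm.comp measurable_snd).indicator Sm
  have Fm : Measurable (fun z : EuclideanSpace ℝ (Fin n) × EuclideanSpace ℝ (Fin n) =>
      ENNReal.ofReal (|u z.1 - u z.2| ^ p / dist z.1 z.2 ^ q)) := by
    apply ENNReal.measurable_ofReal.comp; fun_prop
  set R := ∫⁻ x in Ω, ∫⁻ y in Ω, ENNReal.ofReal (|u x - u y| ^ p / dist x y ^ q) with hR
  -- Claim 1
  have c1 : ∀ x ∈ Ω, ENNReal.ofReal (|u x| ^ p / δ x ^ t) ≤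
      ENNReal.ofReal (K * 2 ^ p) * (∫⁻ y in Ω, ENNReal.ofReal (|u x - u y| ^ p / dist x y ^ q))
        + ∫⁻ y in Ω, G x y := by
    intro x hx
    have hd := hpos x hx
    obtain ⟨c, hc⟩ := hardy_ball hΩ hne l0 l1 x hd
    have Am : MeasurableSet {y | hardyA l δ x y} := measurable_prodMk_left Sm
    have hAΩ : {y | hardyA l δ x y} ⊆ Ω := fun y hy =>
      hpos' y (lt_of_lt_of_le (by positivity) hy.1)
    have e1 : ENNReal.ofReal (|u x| ^ p / δ x ^ t) =
        ENNReal.ofReal (K * (|u x| ^ p / δ x ^ q)) * volume (ball c (l * δ x / 2)) := by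
      rw [Measure.addHaar_ball_of_pos _ _ (by positivity), hwe, ← ENNReal.ofReal_mul (by positivity),
        ← ENNReal.ofReal_mul (by positivity)]
      congr 1
      rw [finrank_euclideanSpace_fin, hK, hqd, Real.rpow_add hd, ← Real.rpow_natCast,
        Real.div_rpow (by norm_num) l0.le, Real.div_rpow (by positivity) (by norm_num),
        Real.mul_rpow l0.le hd.le]
      have h1 : l ^ (n:ℝ) ≠ 0 := by positivity
      have h2 : δ x ^ (n:ℝ) ≠ 0 := by positivity
      have h3 : (2:ℝ) ^ (n:ℝ) ≠ 0 := by positivity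
      field_simp
    have Fxm : Measurable (fun y => ENNReal.ofReal (K * 2 ^ p) *
        ENNReal.ofReal (|u x - u y| ^ p / dist x y ^ q)) :=
      (Fm.comp measurable_prodMk_left).const_mul _
    rw [e1, ← lintegral_const_mul' _ _ ENNReal.ofReal_ne_top, ← lintegral_add_left Fxm]
    calc _ ≤ ENNReal.ofReal (K * (|u x| ^ p / δ x ^ q)) * volume {y | hardyA l δ x y} := by
          gcongr
      _ = ∫⁻ y in {y | hardyA l δ x y}, ENNReal.ofReal (K * (|u x| ^ p / δ x ^ q)) := by
          rw [setLIntegral_const]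
      _ ≤ ∫⁻ y in {y | hardyA l δ x y}, (ENNReal.ofReal (K * 2 ^ p) *
            ENNReal.ofReal (|u x - u y| ^ p / dist x y ^ q) + G x y) := by
          apply setLIntegral_mono' Am
          intro y hy
          have hG : G x y = B y := Set.indicator_of_mem (show (x, y) ∈ S from hy) _
          rw [hG, ← ENNReal.ofReal_mul (by positivity)]
          have he : 0 < δ y := hpos y (hAΩ hy)
          rw [← ENNReal.ofReal_add (by positivity) (by positivity)]
          apply ENNReal.ofReal_le_ofReal
          have := hardy_real (a := u x) (b := u y) hp hq l0 hd he dist_nonneg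
            (fun h => by rw [dist_eq_zero.1 h]) hy.2.1 hy.2.2
          have := mul_le_mul_of_nonneg_left this K0.le
          linarith
      _ ≤ _ := lintegral_mono_set hAΩ
  -- Claim 2
  have c2 : ∀ y ∈ Ω, ∫⁻ x in Ω, G x y ≤
      ENNReal.ofReal (1 / 2) * ENNReal.ofReal (|u y| ^ p / δ y ^ t) := by
    intro y hy
    have he := hpos y hy
    calc ∫⁻ x in Ω, G x y ≤ ∫⁻ x, G x y := setLIntegral_le_lintegral _ _
      _ ≤ ∫⁻ x, (closedBall y (2 * δ y / l)).indicator (fun _ => B y) x := by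
        apply lintegral_mono
        intro x
        change S.indicator (fun z => B z.2) (x, y) ≤ _
        by_cases h : (x, y) ∈ S
        · rw [indicator_of_mem h, indicator_of_mem]
          rw [mem_closedBall, le_div_iff₀ l0]
          have h1 := h.1
          have h2 := h.2.2
          simp only at h1 h2
          have := mul_le_mul_of_nonneg_right h2 l0.le
          linarith
        · rw [indicator_of_notMem h]; exact zero_le
      _ = B y * volume (closedBall y (2 * δ y / l)) := by
        rw [lintegral_indicator measurableSet_closedBall, setLIntegral_const]
      _ ≤ _ := by
        rw [Measure.addHaar_closedBall _ _ (by positivity), hwe, ← ENNReal.ofReal_mul (by positivity),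
          ← ENNReal.ofReal_mul (by positivity), ← ENNReal.ofReal_mul (by positivity)]
        apply ENNReal.ofReal_le_ofReal
        have : K * (2 ^ p * ((2 * l) ^ q * (|u y| ^ p / δ y ^ q))) *
            ((2 * δ y / l) ^ Module.finrank ℝ (EuclideanSpace ℝ (Fin n)) * w) =
            (2 ^ p * (2 / l) ^ (n:ℝ) * (2 / l) ^ (n:ℝ) * (2 * l) ^ q) * (|u y| ^ p / δ y ^ t) := by
          rw [finrank_euclideanSpace_fin, hK, ← Real.rpow_natCast,
            show 2 * δ y / l = (2 / l) * δ y by ring, Real.mul_rpow (by positivity) he.le]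
          have : δ y ^ q = δ y ^ (n:ℝ) * δ y ^ t := by rw [hqd, Real.rpow_add he]
          rw [this]
          have h2 : δ y ^ (n:ℝ) ≠ 0 := by positivity
          field_simp
        rw [this]
        gcongr
  have c3 : L ≤ ENNReal.ofReal (K * 2 ^ p) * R + ENNReal.ofReal (1 / 2) * L := by
    calc L ≤ ∫⁻ x in Ω, (ENNReal.ofReal (K * 2 ^ p) *
          (∫⁻ y in Ω, ENNReal.ofReal (|u x - u y| ^ p / dist x y ^ q)) + ∫⁻ y in Ω, G x y) :=
          setLIntegral_mono' hΩ.measurableSet c1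
      _ = ENNReal.ofReal (K * 2 ^ p) * R + ∫⁻ x in Ω, ∫⁻ y in Ω, G x y := by
          have Gim : Measurable (fun x => ∫⁻ y in Ω, G x y) := Gm.lintegral_prod_right'
          rw [lintegral_add_right _ Gim,
            lintegral_const_mul' _ _ ENNReal.ofReal_ne_top]
      _ = ENNReal.ofReal (K * 2 ^ p) * R + ∫⁻ y in Ω, ∫⁻ x in Ω, G x y := by
          rw [lintegral_lintegral_swap Gm.aemeasurable]
      _ ≤ ENNReal.ofReal (K * 2 ^ p) * R + ∫⁻ y in Ω,
            ENNReal.ofReal (1 / 2) * ENNReal.ofReal (|u y| ^ p / δ y ^ t) := by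
          gcongr 1
          exact setLIntegral_mono' hΩ.measurableSet c2
      _ = _ := by rw [lintegral_const_mul' _ _ ENNReal.ofReal_ne_top]
  rcases eq_or_ne R ⊤ with h | h
  · rw [h, ENNReal.mul_top]
    · exact le_top
    · simp only [ne_eq, ENNReal.ofReal_eq_zero, not_le]; positivity
  · clear_value L R
    clear hL hR
    lift L to NNReal using hfin
    lift R to NNReal using h
    rw [ENNReal.ofReal, ENNReal.ofReal] at c3
    rw [ENNReal.ofReal]
    norm_cast at c3 ⊢
    rw [← NNReal.coe_le_coe] at c3 ⊢
    push_cast at c3 ⊢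
    rw [Real.coe_toNNReal _ (by positivity), Real.coe_toNNReal _ (by positivity)] at c3
    rw [Real.coe_toNNReal _ (by positivity)]
    linarith

lemma hardy_fin_g (n : ℕ) (hn : n ≠ 0) (t p a b : ℝ) (ht : 0 < t) (htp : t < p) :
    ∃ g : EuclideanSpace ℝ (Fin n) → ENNReal, Measurable g ∧ (∀ x, g (-x) = g x) ∧
      ∫⁻ x, g x ≠ ⊤ ∧ ∀ x (v : ℝ), 0 ≤ v → v ≤ a * ‖x‖ → v ≤ b →
        ENNReal.ofReal (v ^ p / ‖x‖ ^ ((n : ℝ) + t)) ≤ g x := by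
  have : Nonempty (Fin n) := ⟨⟨0, Nat.pos_of_ne_zero hn⟩⟩
  let f : ℝ → ℝ := fun r => if r ≤ 1 then |a| ^ p * r ^ (p - n - t) else |b| ^ p * r ^ (-(n:ℝ) - t)
  have fm : Measurable f := Measurable.ite measurableSet_Iic (by fun_prop) (by fun_prop)
  have hf : Integrable (fun x : EuclideanSpace ℝ (Fin n) => f ‖x‖) volume := by
    rw [integrable_fun_norm_addHaar, finrank_euclideanSpace_fin, ← Ioc_union_Ioi_eq_Ioi zero_le_one]
    have hpw : ∀ r : ℝ, 0 < r → r ^ (n - 1) = r ^ ((n:ℝ) - 1) := fun r hr => by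
      rw [← Real.rpow_natCast, Nat.cast_sub (Nat.one_le_iff_ne_zero.2 hn)]; simp
    apply IntegrableOn.union
    · have h1 : IntegrableOn (fun r : ℝ => |a| ^ p * r ^ (p - t - 1)) (Ioc 0 1) := by
        apply Integrable.const_mul
        have := intervalIntegral.intervalIntegrable_rpow' (a := 0) (b := 1)
          (show -1 < p - t - 1 by linarith)
        exact (intervalIntegrable_iff_integrableOn_Ioc_of_le zero_le_one).1 this
      refine h1.congr_fun (fun r hr => ?_) measurableSet_Ioc
      simp only [f, if_pos hr.2, smul_eq_mul]
      rw [hpw r hr.1, show p - t - 1 = ((n:ℝ) - 1) + (p - n - t) by ring, Real.rpow_add hr.1]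
      ring
    · have h1 : IntegrableOn (fun r : ℝ => |b| ^ p * r ^ (- t - 1)) (Ioi 1) := by
        apply Integrable.const_mul
        exact integrableOn_Ioi_rpow_of_lt (by linarith) one_pos
      refine h1.congr_fun (fun r hr => ?_) measurableSet_Ioi
      have hr' : 0 < r := lt_trans one_pos hr
      simp only [f, if_neg (not_le.2 (mem_Ioi.1 hr)), smul_eq_mul]
      rw [hpw r hr', show - t - 1 = ((n:ℝ) - 1) + (-(n:ℝ) - t) by ring, Real.rpow_add hr']
      ring
  have p0 : 0 < p := ht.trans htp
  refine ⟨fun x => ENNReal.ofReal (f ‖x‖), ENNReal.measurable_ofReal.comp (fm.comp measurable_norm),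
    fun x => by simp, ?_, fun x v hv h1 h2 => ?_⟩
  · have := hf.lintegral_lt_top
    exact this.ne
  · apply ENNReal.ofReal_le_ofReal
    rcases (norm_nonneg x).eq_or_lt with h | h
    · rw [← h] at h1 ⊢
      have : v = 0 := by linarith
      subst this
      rw [Real.zero_rpow p0.ne', zero_div]
      simp only [f, if_pos zero_le_one]
      positivity
    · simp only [f]
      split_ifs with h3
      · rw [show p - n - t = p - (n + t) by ring, Real.rpow_sub h, ← mul_div_assoc]
        gcongr
        rw [← Real.mul_rpow (abs_nonneg _) h.le]
        gcongr
        exact h1.trans (by gcongr; exact le_abs_self a)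
      · rw [show -(n:ℝ) - t = -(n + t) by ring, Real.rpow_neg h.le, ← div_eq_mul_inv]
        gcongr
        exact h2.trans (le_abs_self b)

theorem regional_fractional_hardy_supercritical (n : ℕ) (s p : ℝ)
    (hs : s ∈ Set.Ioo (0:ℝ) 1) (hp : 1 < p) (hsp : (n : ℝ) < s * p)
    (Ω : Set (EuclideanSpace ℝ (Fin n))) (hΩ : IsOpen Ω) (hΩne : Ω.Nonempty)
    (hΩprop : Ω ≠ Set.univ) :
    ∃ C : ℝ, 0 < C ∧
      ∀ u : EuclideanSpace ℝ (Fin n) → ℝ,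
        ContDiff ℝ (⊤ : ℕ∞) u → HasCompactSupport u → tsupport u ⊆ Ω →
        (∫ x in Ω, |u x| ^ p / Metric.infDist x Ωᶜ ^ (s * p))
          ≤ C * ∫ x in Ω, ∫ y in Ω, |u x - u y| ^ p / dist x y ^ ((n : ℝ) + s * p) := by
  have hne : (Ωᶜ).Nonempty := nonempty_compl.2 hΩprop
  have hn : n ≠ 0 := by
    rintro rfl
    exact hΩprop (Subsingleton.eq_univ_of_nonempty hΩne)
  have p0 : 0 < p := by linarith
  have ht : 0 < s * p := mul_pos hs.1 p0
  have htp : s * p < p := by nlinarith [hs.2]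
  obtain ⟨C, C0, hC⟩ := hardy_main n (s * p) p hp hsp Ω hΩ hne
  refine ⟨C, C0, fun u hu hcs hsupp => ?_⟩
  have uc : Continuous u := hu.continuous
  have um : Measurable u := uc.measurable
  have δm : Measurable (fun x => infDist x Ωᶜ) := (continuous_infDist_pt _).measurable
  have hpos : ∀ x ∈ Ω, 0 < infDist x Ωᶜ := fun x hx =>
    (hΩ.isClosed_compl.notMem_iff_infDist_pos hne).1 (by simpa using hx)
  have Fm : Measurable (fun z : EuclideanSpace ℝ (Fin n) × EuclideanSpace ℝ (Fin n) =>
      |u z.1 - u z.2| ^ p / dist z.1 z.2 ^ ((n:ℝ) + s * p)) := by fun_prop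
  -- left side is finite
  have hLfin : (∫⁻ x in Ω, ENNReal.ofReal (|u x| ^ p / infDist x Ωᶜ ^ (s * p))) ≠ ⊤ := by
    have hK : IsCompact (tsupport u) := hcs
    have hcont : ContinuousOn (fun x => |u x| ^ p / infDist x Ωᶜ ^ (s * p)) (tsupport u) := by
      apply ContinuousOn.div
      · exact (uc.abs.rpow_const (fun _ => Or.inr p0.le)).continuousOn
      · exact ((continuous_infDist_pt _).rpow_const (fun _ => Or.inr ht.le)).continuousOn
      · intro x hx
        exact (Real.rpow_pos_of_pos (hpos x (hsupp hx)) _).ne'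
    have hInt_a : IntegrableOn (fun x => |u x| ^ p / infDist x Ωᶜ ^ (s * p)) (tsupport u) volume :=
      hcont.integrableOn_compact hK
    have hInt_b : Integrable (fun x => |u x| ^ p / infDist x Ωᶜ ^ (s * p)) volume := by
      rw [← integrableOn_iff_integrable_of_support_subset (s := tsupport u)]
      · exact hInt_a
      · intro x hx
        by_contra h
        apply hx
        simp [image_eq_zero_of_notMem_tsupport h, Real.zero_rpow p0.ne']
    exact (hInt_b.integrableOn (s := Ω)).lintegral_lt_top.ne
  have key := hC u uc hLfin
  -- bounds
  obtain ⟨a, ha⟩ := ContDiff.lipschitzWith_of_hasCompactSupport hcs hu (by simp)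
  obtain ⟨M, hM⟩ := hcs.exists_bound_of_continuous uc
  obtain ⟨g, gm, gneg, gfin, hg⟩ := hardy_fin_g n hn (s * p) p a (2 * M) ht htp
  have hFg : ∀ x y, ENNReal.ofReal (|u x - u y| ^ p / dist x y ^ ((n:ℝ) + s * p)) ≤ g (x - y) := by
    intro x y
    rw [dist_eq_norm]
    apply hg _ _ (abs_nonneg _)
    · have := ha.dist_le_mul x y
      rwa [Real.dist_eq, dist_eq_norm] at this
    · have h1 := hM x
      have h2 := hM y
      rw [Real.norm_eq_abs] at h1 h2
      have := abs_sub (u x) (u y)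
      linarith
  have hinner : ∀ x, ∫⁻ y, g (x - y) = ∫⁻ y, g y := fun x => lintegral_sub_left_eq_self g x
  have hRx : ∀ x, (∫⁻ y in Ω, ENNReal.ofReal (|u x - u y| ^ p / dist x y ^ ((n:ℝ) + s * p))) ≠ ⊤ := by
    intro x
    refine ne_top_of_le_ne_top gfin ?_
    calc _ ≤ ∫⁻ y in Ω, g (x - y) := lintegral_mono (fun y => hFg x y)
      _ ≤ ∫⁻ y, g (x - y) := setLIntegral_le_lintegral _ _
      _ = _ := hinner x
  set T := tsupport u with hT
  have Tm : MeasurableSet T := (isClosed_tsupport u).measurableSet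
  have Tfin : volume T ≠ ⊤ := (show IsCompact T from hcs).measure_lt_top.ne
  have hR : (∫⁻ x in Ω, ∫⁻ y in Ω,
      ENNReal.ofReal (|u x - u y| ^ p / dist x y ^ ((n:ℝ) + s * p))) ≠ ⊤ := by
    have hle : ∀ x y, ENNReal.ofReal (|u x - u y| ^ p / dist x y ^ ((n:ℝ) + s * p)) ≤
        T.indicator 1 x * g (x - y) + T.indicator 1 y * g (x - y) := by
      intro x y
      by_cases hx : x ∈ T
      · simp only [indicator_of_mem hx, Pi.one_apply, one_mul]
        exact (hFg x y).trans le_self_add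
      by_cases hy : y ∈ T
      · simp only [indicator_of_mem hy, Pi.one_apply, one_mul]
        exact (hFg x y).trans le_add_self
      · simp [image_eq_zero_of_notMem_tsupport hx, image_eq_zero_of_notMem_tsupport hy,
          Real.zero_rpow p0.ne']
    have im : Measurable (T.indicator (1 : EuclideanSpace ℝ (Fin n) → ENNReal)) :=
      measurable_one.indicator Tm
    have m1 : Measurable (fun z : EuclideanSpace ℝ (Fin n) × EuclideanSpace ℝ (Fin n) =>
        T.indicator (1 : EuclideanSpace ℝ (Fin n) → ENNReal) z.1 * g (z.1 - z.2)) :=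
      (im.comp measurable_fst).mul (gm.comp (measurable_fst.sub measurable_snd))
    have m2 : Measurable (fun z : EuclideanSpace ℝ (Fin n) × EuclideanSpace ℝ (Fin n) =>
        T.indicator (1 : EuclideanSpace ℝ (Fin n) → ENNReal) z.2 * g (z.1 - z.2)) :=
      (im.comp measurable_snd).mul (gm.comp (measurable_fst.sub measurable_snd))
    have i1 : ∫⁻ x, ∫⁻ y, T.indicator (1 : EuclideanSpace ℝ (Fin n) → ENNReal) x * g (x - y)
        = volume T * ∫⁻ y, g y := by
      have : ∀ x, ∫⁻ y, T.indicator (1 : EuclideanSpace ℝ (Fin n) → ENNReal) x * g (x - y)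
          = T.indicator 1 x * ∫⁻ y, g y := fun x => by
        have gxm : Measurable (fun y => g (x - y)) := gm.comp (measurable_const.sub measurable_id)
        rw [lintegral_const_mul _ gxm, hinner]
      simp_rw [this]
      rw [lintegral_mul_const _ im, lintegral_indicator_one Tm]
    have i2 : ∫⁻ x, ∫⁻ y, T.indicator (1 : EuclideanSpace ℝ (Fin n) → ENNReal) y * g (x - y)
        = volume T * ∫⁻ y, g y := by
      rw [lintegral_lintegral_swap m2.aemeasurable, ← i1]
      refine lintegral_congr fun y => lintegral_congr fun x => ?_
      rw [← gneg, neg_sub]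
    refine ne_top_of_le_ne_top (b := volume T * (∫⁻ y, g y) + volume T * ∫⁻ y, g y) ?_ ?_
    · exact ENNReal.add_ne_top.2 ⟨ENNReal.mul_ne_top Tfin gfin, ENNReal.mul_ne_top Tfin gfin⟩
    calc _ ≤ ∫⁻ x in Ω, ∫⁻ y, ENNReal.ofReal (|u x - u y| ^ p / dist x y ^ ((n:ℝ) + s * p)) :=
          lintegral_mono fun x => setLIntegral_le_lintegral _ _
      _ ≤ ∫⁻ x, ∫⁻ y, ENNReal.ofReal (|u x - u y| ^ p / dist x y ^ ((n:ℝ) + s * p)) :=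
          setLIntegral_le_lintegral _ _
      _ ≤ ∫⁻ x, ∫⁻ y, (T.indicator (1 : EuclideanSpace ℝ (Fin n) → ENNReal) x * g (x - y)
            + T.indicator 1 y * g (x - y)) :=
          lintegral_mono fun x => lintegral_mono fun y => hle x y
      _ = ∫⁻ x, ((∫⁻ y, T.indicator (1 : EuclideanSpace ℝ (Fin n) → ENNReal) x * g (x - y))
            + ∫⁻ y, T.indicator 1 y * g (x - y)) :=
          lintegral_congr fun x => lintegral_add_left (m1.comp measurable_prodMk_left) _
      _ = _ := by rw [lintegral_add_left m1.lintegral_prod_right', i1, i2]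
  -- conversion
  have eL : (∫ x in Ω, |u x| ^ p / infDist x Ωᶜ ^ (s * p)) =
      (∫⁻ x in Ω, ENNReal.ofReal (|u x| ^ p / infDist x Ωᶜ ^ (s * p))).toReal := by
    apply integral_eq_lintegral_of_nonneg_ae
    · exact Filter.Eventually.of_forall fun x => by
        have : 0 ≤ infDist x Ωᶜ := infDist_nonneg
        change 0 ≤ |u x| ^ p / infDist x Ωᶜ ^ (s * p)
        positivity
    · have : Measurable (fun x => |u x| ^ p / infDist x Ωᶜ ^ (s * p)) := by fun_prop
      exact this.aestronglyMeasurable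
  have eI : ∀ x, (∫ y in Ω, |u x - u y| ^ p / dist x y ^ ((n : ℝ) + s * p)) =
      (∫⁻ y in Ω, ENNReal.ofReal (|u x - u y| ^ p / dist x y ^ ((n : ℝ) + s * p))).toReal := by
    intro x
    apply integral_eq_lintegral_of_nonneg_ae
    · exact Filter.Eventually.of_forall fun y => by
        change 0 ≤ |u x - u y| ^ p / dist x y ^ ((n : ℝ) + s * p)
        positivity
    · exact (Fm.comp measurable_prodMk_left).aestronglyMeasurable
  have Im : Measurable (fun x => ∫⁻ y in Ω,
      ENNReal.ofReal (|u x - u y| ^ p / dist x y ^ ((n : ℝ) + s * p))) :=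
    (ENNReal.measurable_ofReal.comp Fm).lintegral_prod_right'
  have eR : (∫ x in Ω, ∫ y in Ω, |u x - u y| ^ p / dist x y ^ ((n : ℝ) + s * p)) =
      (∫⁻ x in Ω, ∫⁻ y in Ω,
        ENNReal.ofReal (|u x - u y| ^ p / dist x y ^ ((n : ℝ) + s * p))).toReal := by
    simp_rw [eI]
    exact integral_toReal Im.aemeasurable
      (Filter.Eventually.of_forall fun x => (hRx x).lt_top)
  rw [eL, eR, ← ENNReal.toReal_ofReal C0.le, ← ENNReal.toReal_mul]
  exact ENNReal.toReal_mono (ENNReal.mul_ne_top ENNReal.ofReal_ne_top hR) key
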